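/- Let P be a penny configuration in general position and let L, U, R, D ∈ P form a kernel. Then every point of P \ {L,U,R,D} at distance exactly 1 from one of L, U, R, D is at distance exactly 1 from exactly one of them; the set N of all such points has exactly 10 elements; and N admits a cyclic ordering w₁, w₂, …, w₁₀ in which every two cyclically consecutive points are at distance exactly 1 (i.e., dist(wᵢ, wᵢ₊₁) = 1 for all i, indices modulo 10). -/

import Mathlib

open Real EuclideanGeometry

/-- The Euclidean plane. -/
abbrev Pt := EuclideanSpace ℝ (Fin 2)

/-- A penny configuration in general position: a finite set of points in the plane
such that any two distinct points are at distance at least 1 and no three points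
are collinear. -/
def PennyGP (P : Finset Pt) : Prop :=
  (∀ p ∈ P, ∀ q ∈ P, p ≠ q → 1 ≤ dist p q) ∧
  (∀ p ∈ P, ∀ q ∈ P, ∀ r ∈ P, p ≠ q → p ≠ r → q ≠ r →
    ¬ Collinear ℝ ({p, q, r} : Set Pt))

/-- The degree of a point `A` in the penny graph of `P`: the number of points of `P`
at distance exactly 1 from `A`. -/
noncomputable def deg (P : Finset Pt) (A : Pt) : ℕ :=
  {q : Pt | q ∈ P ∧ dist A q = 1}.ncard

/-- A kernel: four distinct points of `P`, each of degree 5, with the five unit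
distances `LU`, `UR`, `RD`, `DL`, `LR`. -/
def IsKernel (P : Finset Pt) (L U R D : Pt) : Prop :=
  L ∈ P ∧ U ∈ P ∧ R ∈ P ∧ D ∈ P ∧
  List.Pairwise (· ≠ ·) [L, U, R, D] ∧
  deg P L = 5 ∧ deg P U = 5 ∧ deg P R = 5 ∧ deg P D = 5 ∧
  dist L U = 1 ∧ dist U R = 1 ∧ dist R D = 1 ∧ dist D L = 1 ∧ dist L R = 1

/-- A point belongs to a kernel if it is one of the four points of some kernel of `P`. -/
def InKernel (P : Finset Pt) (X : Pt) : Prop :=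
  ∃ L U R D : Pt, IsKernel P L U R D ∧ X ∈ ({L, U, R, D} : Set Pt)

section ApricotLemmas

open Set

lemma pairwise_ne_four {α : Type*} {a b c d : α} :
    List.Pairwise (· ≠ ·) [a, b, c, d] ↔ a ≠ b ∧ a ≠ c ∧ a ≠ d ∧ b ≠ c ∧ b ≠ d ∧ c ≠ d := by
  simp [and_assoc]

/-- The unit vector in direction `θ`. -/
noncomputable def unitVec (θ : ℝ) : Pt := !₂[cos θ, sin θ]

lemma unitVec_add_pi (θ : ℝ) : unitVec (θ + π) = -unitVec θ := by
  ext i; fin_cases i <;> simp [unitVec]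

lemma unitVec_add_two_pi (θ : ℝ) : unitVec (θ + 2 * π) = unitVec θ := by
  ext i; fin_cases i <;> simp [unitVec]

lemma unitVec_add_pi_div_three (θ : ℝ) :
    unitVec (θ + π / 3) = unitVec θ - unitVec (θ - π / 3) := by
  ext i; fin_cases i <;> simp [unitVec, cos_add, sin_add, cos_sub, sin_sub] <;> ring

lemma dist_sq_eq (p q : Pt) : dist p q ^ 2 = (p 0 - q 0) ^ 2 + (p 1 - q 1) ^ 2 := by
  rw [EuclideanSpace.dist_eq, Real.sq_sqrt (by positivity)]
  simp [Fin.sum_univ_two, Real.dist_eq]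

lemma dist_add_unitVec_self (X : Pt) (θ : ℝ) : dist (X + unitVec θ) X = 1 := by
  rw [← sq_eq_sq₀ dist_nonneg zero_le_one, dist_sq_eq]
  simp [unitVec]

lemma dist_add_unitVec_sq (X : Pt) (a b : ℝ) :
    dist (X + unitVec a) (X + unitVec b) ^ 2 = 2 - 2 * cos (b - a) := by
  rw [dist_sq_eq]
  simp only [unitVec, PiLp.add_apply, Matrix.cons_val_zero, Matrix.cons_val_one, cos_sub]
  linarith [sin_sq_add_cos_sq a, sin_sq_add_cos_sq b]

lemma dist_add_unitVec_pi_div_three (X : Pt) {a b : ℝ} (h : b = a + π / 3) :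
    dist (X + unitVec a) (X + unitVec b) = 1 := by
  rw [h, ← sq_eq_sq₀ dist_nonneg zero_le_one, dist_add_unitVec_sq, add_sub_cancel_left,
    cos_pi_div_three]
  norm_num

lemma exists_unitVec {X Y : Pt} (h : dist Y X = 1) (a : ℝ) :
    ∃ θ, a ≤ θ ∧ θ < a + 2 * π ∧ Y = X + unitVec θ := by
  obtain ⟨z, hre, him⟩ : ∃ z : ℂ, z.re = Y 0 - X 0 ∧ z.im = Y 1 - X 1 := ⟨⟨_, _⟩, rfl, rfl⟩
  have hz1 : ‖z‖ = 1 := by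
    rw [← sq_eq_sq₀ (norm_nonneg _) zero_le_one, ← h, dist_sq_eq, ← Complex.normSq_eq_norm_sq,
      Complex.normSq_apply, hre, him]
    ring
  have hc := Complex.norm_mul_cos_arg z
  have hs := Complex.norm_mul_sin_arg z
  rw [hz1, one_mul] at hc hs
  refine ⟨toIcoMod two_pi_pos a z.arg, left_le_toIcoMod _ _ _, toIcoMod_lt_right _ _ _, ?_⟩
  have hm : toIcoMod two_pi_pos a z.arg = z.arg - toIcoDiv two_pi_pos a z.arg * (2 * π) := by
    rw [toIcoMod, zsmul_eq_mul]
  rw [hre, ← cos_sub_int_mul_two_pi _ (toIcoDiv two_pi_pos a z.arg), ← hm] at hc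
  rw [him, ← sin_sub_int_mul_two_pi _ (toIcoDiv two_pi_pos a z.arg), ← hm] at hs
  ext i
  fin_cases i <;> simp [unitVec, hc, hs]

/-- Two unit vectors at distance at least one subtend an angle of at least `π / 3`. -/
lemma angle_sep {X : Pt} {a b : ℝ} (h : 1 ≤ dist (X + unitVec a) (X + unitVec b))
    (hab : a ≤ b) (hb : b ≤ a + 2 * π) : a + π / 3 ≤ b ∧ b + π / 3 ≤ a + 2 * π := by
  have hc : cos (b - a) ≤ 1 / 2 := by
    have := dist_add_unitVec_sq X a b
    nlinarith
  have hpi := pi_pos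
  constructor <;> by_contra! hlt
  · have := cos_lt_cos_of_nonneg_of_le_pi (sub_nonneg.2 hab) (by linarith : π / 3 ≤ π)
      (by linarith)
    rw [cos_pi_div_three] at this
    linarith
  · have := cos_lt_cos_of_nonneg_of_le_pi (by linarith : 0 ≤ 2 * π - (b - a))
      (by linarith : π / 3 ≤ π) (by linarith)
    rw [cos_pi_div_three, cos_two_pi_sub] at this
    linarith

lemma add_unitVec_ne {X : Pt} {a b : ℝ} (hab : a < b) (hb : b < a + 2 * π) :
    X + unitVec a ≠ X + unitVec b := by
  intro h
  have hd := dist_add_unitVec_sq X a b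
  rw [h, dist_self] at hd
  have := (cos_eq_one_iff_of_lt_of_lt (x := b - a) (by linarith [pi_pos]) (by linarith)).1
    (by linarith)
  linarith

/-- In a quadrilateral with three unit sides, a fourth side of length at least one forces the
two angles at the opposite side to have sum at least `π`. -/
lemma angle_le_of_one_le_dist {X Y : Pt} {φ d p : ℝ} (hY : Y = X + unitVec φ)
    (h : 1 ≤ dist (X + unitVec d) (Y + unitVec p))
    (hd : d ≤ φ - π / 3) (hp : φ - 2 * π / 3 ≤ p) : d ≤ p := by
  by_contra! hlt
  have hpi := pi_pos
  obtain ⟨m, δ, rfl, rfl⟩ : ∃ m δ, d = φ - m + δ ∧ p = φ - m - δ :=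
    ⟨φ - (d + p) / 2, (d - p) / 2, by ring, by ring⟩
  have hdist : dist (X + unitVec (φ - m + δ)) (Y + unitVec (φ - m - δ)) ^ 2 =
      1 - 4 * sin δ * (sin m - sin δ) := by
    rw [dist_sq_eq, hY]
    simp only [unitVec, PiLp.add_apply, Matrix.cons_val_zero, Matrix.cons_val_one]
    generalize hψ : φ - m = ψ
    obtain rfl : φ = ψ + m := by linarith
    simp only [cos_sub, sin_sub, cos_add, sin_add]
    have h1 := sin_sq_add_cos_sq ψ
    have h2 := sin_sq_add_cos_sq m
    linear_combination (4 * sin δ ^ 2 - 4 * sin δ * sin m + cos m ^ 2 + sin m ^ 2) * h1 + h2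
  have hsin : 0 < sin δ := sin_pos_of_pos_of_lt_pi (by linarith) (by linarith)
  have hlt' : sin δ < sin m := by
    rcases le_total m (π / 2) with hm | hm
    · exact sin_lt_sin_of_lt_of_le_pi_div_two (by linarith) hm (by linarith)
    · rw [← sin_pi_sub m]
      exact sin_lt_sin_of_lt_of_le_pi_div_two (by linarith) (by linarith) (by linarith)
  nlinarith [mul_pos hsin (sub_pos.2 hlt')]

/-- `L, U, R, D` form a rhombus of two unit equilateral triangles, in clockwise order, with
short diagonal `LR` in direction `φ`. -/
structure IsRhombus (φ : ℝ) (L U R D : Pt) : Prop where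
  right : R = L + unitVec φ
  up : U = L + unitVec (φ + π / 3)
  down : D = L + unitVec (φ - π / 3)

namespace IsRhombus

variable {φ : ℝ} {L U R D : Pt}

lemma add_eq (h : IsRhombus φ L U R D) : U + D = L + R := by
  rw [h.right, h.up, h.down, unitVec_add_pi_div_three]
  abel

lemma rotate (h : IsRhombus φ L U R D) : IsRhombus (φ + π) R D L U where
  right := by rw [h.right, unitVec_add_pi]; abel
  up := by
    rw [h.right, h.down, add_right_comm φ, unitVec_add_pi, unitVec_add_pi_div_three]; abel
  down := by
    rw [h.right, h.up, add_sub_right_comm, unitVec_add_pi, unitVec_add_pi_div_three]; abel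

lemma left_eq (h : IsRhombus φ L U R D) : L = U + unitVec (φ + 4 * π / 3) := by
  rw [h.up, show φ + 4 * π / 3 = φ + π / 3 + π by ring, unitVec_add_pi]; abel

lemma right_eq (h : IsRhombus φ L U R D) : R = U + unitVec (φ - π / 3) := by
  rw [h.right, h.up, unitVec_add_pi_div_three]; abel

lemma dist_up_down (h : IsRhombus φ L U R D) : dist U D ≠ 1 := by
  intro h1
  have h2 := dist_add_unitVec_sq L (φ - π / 3) (φ + π / 3)
  rw [← h.up, ← h.down, dist_comm, h1, show φ + π / 3 - (φ - π / 3) = 2 * (π / 3) by ring,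
    cos_two_mul, cos_pi_div_three] at h2
  norm_num at h2

end IsRhombus

/-- The points of `P` outside `K` at unit distance from `X`. -/
def outerNbrs (P : Finset Pt) (K : Set Pt) (X : Pt) : Set Pt :=
  {w | w ∈ P ∧ w ∉ K ∧ dist w X = 1}

lemma ncard_outerNbrs {P : Finset Pt} {K s : Set Pt} {X : Pt}
    (hs : ∀ w ∈ K, w ∈ s ↔ dist w X = 1) (hsK : s ⊆ K) (hKP : K ⊆ P) :
    (outerNbrs P K X).ncard = deg P X - s.ncard := by
  have hfin : s.Finite := P.finite_toSet.subset (hsK.trans hKP)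
  rw [deg, ← ncard_sdiff _ hfin]
  · congr 1
    ext w
    simp only [outerNbrs, mem_ofPred_eq, mem_sdiff, dist_comm X]
    constructor
    · exact fun ⟨h1, h2, h3⟩ => ⟨⟨h1, h3⟩, fun h => h2 (hsK h)⟩
    · exact fun ⟨⟨h1, h2⟩, h3⟩ => ⟨h1, fun h => h3 ((hs w h).2 h2), h2⟩
  · exact fun w hw => ⟨hKP (hsK hw), by rw [dist_comm]; exact (hs w (hsK hw)).1 hw⟩

section Nbrs

variable {P : Finset Pt} {φ : ℝ} {L U R D : Pt}

lemma exists_outerNbrs_left (hsep : ∀ p ∈ P, ∀ q ∈ P, p ≠ q → 1 ≤ dist p q)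
    (h : IsRhombus φ L U R D) (hKP : ({L, U, R, D} : Set Pt) ⊆ P)
    (hne : List.Pairwise (· ≠ ·) [L, U, R, D]) (hdeg : deg P L = 5) :
    ∃ a b, φ + 2 * π / 3 ≤ a ∧ a + π / 3 ≤ b ∧ b ≤ φ + 4 * π / 3 ∧
      outerNbrs P {L, U, R, D} L = {L + unitVec a, L + unitVec b} := by
  have hpi := pi_pos
  have hcard : (outerNbrs P {L, U, R, D} L).ncard = 2 := by
    rw [ncard_outerNbrs (s := {U, R, D}) _ _ hKP, hdeg, ncard_eq_three.2]
    · refine ⟨U, R, D, ?_⟩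
      simp_all
    · have h1 : dist R L = 1 := by rw [h.right, dist_add_unitVec_self]
      have h2 : dist U L = 1 := by rw [h.up, dist_add_unitVec_self]
      have h3 : dist D L = 1 := by rw [h.down, dist_add_unitVec_self]
      have h4 : dist L L = 0 := dist_self L
      rintro w (rfl | rfl | rfl | rfl) <;> simp_all
    · exact fun w hw => Or.inr hw
  obtain ⟨x, y, hxy, hS⟩ := ncard_eq_two.1 hcard
  have key : ∀ w ∈ outerNbrs P {L, U, R, D} L,
      ∃ θ, φ + 2 * π / 3 ≤ θ ∧ θ ≤ φ + 4 * π / 3 ∧ w = L + unitVec θ := by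
    rintro w ⟨hwP, hwK, hw⟩
    obtain ⟨θ, h1, h2, rfl⟩ := exists_unitVec hw φ
    have hs : ∀ K ∈ ({L, U, R, D} : Set Pt), 1 ≤ dist K (L + unitVec θ) := fun K hK =>
      hsep _ (hKP hK) _ hwP (by rintro rfl; exact hwK hK)
    have hR := hs R (by simp)
    have hU := hs U (by simp)
    have hD := hs D (by simp)
    rw [h.right] at hR
    rw [h.up] at hU
    rw [h.down, ← unitVec_add_two_pi] at hD
    obtain ⟨h3, h4⟩ := angle_sep hR h1 h2.le
    obtain ⟨h5, -⟩ := angle_sep hU h3 (by linarith)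
    rw [dist_comm] at hD
    obtain ⟨h6, -⟩ := angle_sep hD (by linarith) (by linarith)
    exact ⟨θ, by linarith, by linarith, rfl⟩
  have hx : x ∈ outerNbrs P {L, U, R, D} L := by simp [hS]
  have hy : y ∈ outerNbrs P {L, U, R, D} L := by simp [hS]
  have hd := hsep _ hx.1 _ hy.1 hxy
  obtain ⟨a, ha1, ha2, rfl⟩ := key x hx
  obtain ⟨b, hb1, hb2, rfl⟩ := key y hy
  rcases le_total a b with hab | hab
  · exact ⟨a, b, ha1, (angle_sep hd hab (by linarith)).1, hb2, hS⟩
  · rw [dist_comm] at hd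
    exact ⟨b, a, hb1, (angle_sep hd hab (by linarith)).1, ha2, by rw [hS, pair_comm]⟩

lemma exists_outerNbrs_up (hsep : ∀ p ∈ P, ∀ q ∈ P, p ≠ q → 1 ≤ dist p q)
    (h : IsRhombus φ L U R D) (hKP : ({L, U, R, D} : Set Pt) ⊆ P)
    (hne : List.Pairwise (· ≠ ·) [L, U, R, D]) (hdeg : deg P U = 5) :
    ∃ a b c, φ ≤ a ∧ a + π / 3 ≤ b ∧ b + π / 3 ≤ c ∧ c ≤ φ + π ∧
      outerNbrs P {L, U, R, D} U = {U + unitVec a, U + unitVec b, U + unitVec c} := by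
  have hpi := pi_pos
  have hcard : (outerNbrs P {L, U, R, D} U).ncard = 3 := by
    rw [ncard_outerNbrs (s := {L, R}) _ _ hKP, hdeg, ncard_eq_two.2]
    · refine ⟨L, R, ?_⟩
      simp_all
    · have h1 : dist R U = 1 := by rw [h.right_eq, dist_add_unitVec_self]
      have h2 : dist L U = 1 := by rw [h.left_eq, dist_add_unitVec_self]
      have h3 : dist D U ≠ 1 := by rw [dist_comm]; exact h.dist_up_down
      have h4 : dist U U = 0 := dist_self U
      simp only [List.pairwise_cons, List.mem_cons] at hne
      rintro w (rfl | rfl | rfl | rfl) <;> simp_all [eq_comm]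
    · intro w; simp only [mem_insert_iff, mem_singleton_iff]; tauto
  obtain ⟨x, y, z, hxy, hxz, hyz, hS⟩ := ncard_eq_three.1 hcard
  have key : ∀ w ∈ outerNbrs P {L, U, R, D} U,
      ∃ θ, φ ≤ θ ∧ θ ≤ φ + π ∧ w = U + unitVec θ := by
    rintro w ⟨hwP, hwK, hw⟩
    obtain ⟨θ, h1, h2, rfl⟩ := exists_unitVec hw (φ - π / 3)
    have hs : ∀ K ∈ ({L, U, R, D} : Set Pt), 1 ≤ dist K (U + unitVec θ) := fun K hK =>
      hsep _ (hKP hK) _ hwP (by rintro rfl; exact hwK hK)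
    have hR := hs R (by simp)
    have hL := hs L (by simp)
    rw [h.right_eq] at hR
    rw [h.left_eq, dist_comm] at hL
    obtain ⟨h3, h4⟩ := angle_sep hR h1 h2.le
    obtain ⟨h6, -⟩ := angle_sep hL (by linarith) (by linarith)
    exact ⟨θ, by linarith, by linarith, rfl⟩
  have hx : x ∈ outerNbrs P {L, U, R, D} U := by simp [hS]
  have hy : y ∈ outerNbrs P {L, U, R, D} U := by simp [hS]
  have hz : z ∈ outerNbrs P {L, U, R, D} U := by simp [hS]
  have hd1 := hsep _ hx.1 _ hy.1 hxy
  have hd2 := hsep _ hx.1 _ hz.1 hxz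
  have hd3 := hsep _ hy.1 _ hz.1 hyz
  obtain ⟨a, ha1, ha2, rfl⟩ := key x hx
  obtain ⟨b, hb1, hb2, rfl⟩ := key y hy
  obtain ⟨c, hc1, hc2, rfl⟩ := key z hz
  have sorted : ∀ {a b c : ℝ}, φ ≤ a → a ≤ b → b ≤ c → c ≤ φ + π →
      1 ≤ dist (U + unitVec a) (U + unitVec b) → 1 ≤ dist (U + unitVec b) (U + unitVec c) →
      a + π / 3 ≤ b ∧ b + π / 3 ≤ c := fun h1 h2 h3 h4 h5 h6 =>
    ⟨(angle_sep h5 h2 (by linarith)).1, (angle_sep h6 h3 (by linarith)).1⟩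
  have hd1' := hd1
  have hd2' := hd2
  have hd3' := hd3
  rw [dist_comm] at hd1' hd2' hd3'
  rcases le_total a b with hab | hab <;> rcases le_total b c with hbc | hbc <;>
    rcases le_total a c with hac | hac
  · exact ⟨a, b, c, ha1, (sorted ha1 hab hbc hc2 hd1 hd3).1,
      (sorted ha1 hab hbc hc2 hd1 hd3).2, hc2, hS⟩
  · exact ⟨a, b, c, ha1, (sorted ha1 hab hbc hc2 hd1 hd3).1,
      (sorted ha1 hab hbc hc2 hd1 hd3).2, hc2, hS⟩
  · exact ⟨a, c, b, ha1, (sorted ha1 hac hbc hb2 hd2 hd3').1,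
      (sorted ha1 hac hbc hb2 hd2 hd3').2, hb2, by rw [hS, pair_comm]⟩
  · exact ⟨c, a, b, hc1, (sorted hc1 hac hab hb2 hd2' hd1).1,
      (sorted hc1 hac hab hb2 hd2' hd1).2, hb2, by rw [hS, pair_comm, insert_comm]⟩
  · exact ⟨b, a, c, hb1, (sorted hb1 hab hac hc2 hd1' hd2).1,
      (sorted hb1 hab hac hc2 hd1' hd2).2, hc2, by rw [hS, insert_comm]⟩
  · exact ⟨b, c, a, hb1, (sorted hb1 hbc hac ha2 hd3 hd2').1,
      (sorted hb1 hbc hac ha2 hd3 hd2').2, ha2, by rw [hS, insert_comm, pair_comm]⟩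
  · exact ⟨c, b, a, hc1, (sorted hc1 hbc hab ha2 hd3' hd1').1,
      (sorted hc1 hbc hab ha2 hd3' hd1').2, ha2, by
        rw [hS, insert_comm, pair_comm, insert_comm]⟩
  · exact ⟨c, b, a, hc1, (sorted hc1 hbc hab ha2 hd3' hd1').1,
      (sorted hc1 hbc hab ha2 hd3' hd1').2, ha2, by
        rw [hS, insert_comm, pair_comm, insert_comm]⟩

end Nbrs

/-- The reflection of a point of a penny configuration in general position in another one does
not belong to the configuration. -/
lemma PennyGP.ne_reflection {P : Finset Pt} (hP : PennyGP P) {A B w : Pt} (hA : A ∈ P)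
    (hB : B ∈ P) (hw : w ∈ P) (hAB : A ≠ B) : w + B ≠ A + A := by
  intro h
  have hwA : w = A + (A - B) := by rw [← add_sub_assoc, ← h]; abel
  refine hP.2 A hA B hB w hw hAB ?_ ?_ ?_
  · rintro rfl
    exact hAB (add_left_cancel h).symm
  · rintro rfl
    have h2 : (2 : ℝ) • B = (2 : ℝ) • A := by rw [two_smul, two_smul, h]
    exact hAB (smul_right_injective Pt two_ne_zero h2).symm
  · rw [collinear_iff_of_mem (p₀ := A) (by simp)]
    refine ⟨A - B, ?_⟩
    rintro p (rfl | rfl | rfl)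
    · exact ⟨0, by simp⟩
    · exact ⟨-1, by simp⟩
    · exact ⟨1, by simp [hwA, add_comm]⟩

lemma eq_or_eq_of_dist_eq_one {A B p q w : Pt} (hAB : A ≠ B) (hpq : p ≠ q)
    (hpA : dist p A = 1) (hpB : dist p B = 1) (hqA : dist q A = 1) (hqB : dist q B = 1)
    (hwA : dist w A = 1) (hwB : dist w B = 1) : w = p ∨ w = q :=
  eq_of_dist_eq_of_dist_eq_of_finrank_eq_two (by simp) hAB hpq hpA hqA hwA hpB hqB hwB

section Unique

variable {P : Finset Pt} {L U R D w : Pt}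

/-- A side of the rhombus has no outer common neighbour. -/
lemma PennyGP.not_common_nbr_side (hP : PennyGP P) (hL : L ∈ P) (hD : D ∈ P) (hLD : L ≠ D)
    (hLU : dist L U = 1) (hUR : dist U R = 1) (hDL : dist D L = 1) (hLR : dist L R = 1)
    (hadd : U + D = L + R) (hw : w ∈ P) (hwR : w ≠ R) (hwL : dist w L = 1) (hwU : dist w U = 1) :
    False := by
  have hLU' : L ≠ U := by rintro rfl; simp at hLU
  by_cases hq : R = L + L - D
  · have h2 : U = L + L + L - D - D := by
      rw [hq] at hadd
      rw [← add_sub_cancel_right U D, hadd]; abel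
    have h3 : dist U L = dist (D + D) (L + L) := by
      rw [h2, dist_comm, dist_eq_norm, dist_eq_norm]; congr 1; abel
    rw [← two_smul ℝ, ← two_smul ℝ, dist_smul₀, dist_comm, hLU, hDL] at h3
    norm_num at h3
  · have hD' : D = L + R - U := by rw [← hadd]; abel
    have h1 : dist (L + L - D) L = 1 := by
      rw [← hDL, dist_comm D, dist_eq_norm, dist_eq_norm]; congr 1; abel
    have h2 : dist (L + L - D) U = 1 := by
      rw [← hLR, dist_eq_norm, dist_eq_norm, hD']; congr 1; abel
    rcases eq_or_eq_of_dist_eq_one (w := w) hLU' hq (by rw [dist_comm, hLR])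
      (by rw [dist_comm, hUR]) h1 h2 hwL hwU with h | h
    · exact hwR h
    · exact hP.ne_reflection hL hD hw hLD (by rw [h]; abel)

lemma IsKernel.swap (hk : IsKernel P L U R D) : IsKernel P L D R U := by
  obtain ⟨hL, hU, hR, hD, hne, dL, dU, dR, dD, h1, h2, h3, h4, h5⟩ := hk
  obtain ⟨nLU, nLR, nLD, nUR, nUD, nRD⟩ := pairwise_ne_four.1 hne
  refine ⟨hL, hD, hR, hU, pairwise_ne_four.2 ⟨nLD, nLR, nLU, nRD.symm, nUD.symm, nUR.symm⟩,
    dL, dD, dR, dU, ?_, ?_, ?_, ?_, h5⟩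
  all_goals rw [dist_comm]; assumption

lemma IsKernel.exists_isRhombus (hk : IsKernel P L U R D) :
    ∃ φ, IsRhombus φ L U R D ∨ IsRhombus φ L D R U := by
  obtain ⟨-, -, -, -, hne, -, -, -, -, hLU, hUR, hRD, hDL, hLR⟩ := hk
  have hpi := pi_pos
  obtain ⟨φ, -, -, hR⟩ := exists_unitVec (X := L) (Y := R) (by rw [dist_comm, hLR]) 0
  have hLR' : L ≠ R := by rintro rfl; simp at hLR
  have hUD : U ≠ D := by simp_all
  have key : ∀ w, dist w L = 1 → dist w R = 1 →
      w = L + unitVec (φ - π / 3) ∨ w = L + unitVec (φ + π / 3) := by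
    refine fun w => eq_or_eq_of_dist_eq_one hLR' (add_unitVec_ne (by linarith) (by linarith))
      (dist_add_unitVec_self _ _) ?_ (dist_add_unitVec_self _ _) ?_
    · rw [hR, dist_add_unitVec_pi_div_three _ (by ring)]
    · rw [hR, dist_comm, dist_add_unitVec_pi_div_three _ rfl]
  refine ⟨φ, ?_⟩
  rcases key U (by rw [dist_comm, hLU]) hUR with h1 | h1 <;>
    rcases key D hDL (by rw [dist_comm, hRD]) with h2 | h2
  · exact absurd (h1.trans h2.symm) hUD
  · exact Or.inr ⟨hR, h2, h1⟩
  · exact Or.inl ⟨hR, h1, h2⟩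
  · exact absurd (h1.trans h2.symm) hUD

lemma IsKernel.subset (hk : IsKernel P L U R D) : ({L, U, R, D} : Set Pt) ⊆ P := by
  obtain ⟨hL, hU, hR, hD, -⟩ := hk
  rintro w (rfl | rfl | rfl | rfl) <;> assumption

lemma IsKernel.eq_of_dist_eq_one (hP : PennyGP P) (hk : IsKernel P L U R D)
    (hadd : U + D = L + R) (hw : w ∈ P) (hwK : w ∉ ({L, U, R, D} : Set Pt)) {K K' : Pt}
    (hK : K ∈ ({L, U, R, D} : Set Pt)) (hK' : K' ∈ ({L, U, R, D} : Set Pt))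
    (h : dist w K = 1) (h' : dist w K' = 1) : K = K' := by
  obtain ⟨hL, hU, hR, hD, hne, -, -, -, -, hLU, hUR, hRD, hDL, hLR⟩ := hk
  simp only [mem_insert_iff, mem_singleton_iff, not_or] at hwK
  obtain ⟨hwL, hwU, hwR, hwD⟩ := hwK
  obtain ⟨nLU, nLR, nLD, nUR, nUD, nRD⟩ := pairwise_ne_four.1 hne
  have hUL := hLU
  have hRU := hUR
  have hDR := hRD
  have hLD := hDL
  have hRL := hLR
  rw [dist_comm] at hUL hRU hDR hLD hRL
  have sLU := hP.not_common_nbr_side hL hD nLD hLU hUR hDL hLR hadd hw hwR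
  have sLD := hP.not_common_nbr_side hL hU nLU hLD hDR hUL hLR (by rw [add_comm, hadd]) hw hwR
  have sRU := hP.not_common_nbr_side hR hD nRD hRU hUL hDR hRL (by rw [hadd, add_comm]) hw hwL
  have sRD := hP.not_common_nbr_side hR hU nUR.symm hRD hDL hUR hRL
    (by rw [add_comm, hadd, add_comm]) hw hwL
  have sLR : dist w L = 1 → dist w R = 1 → False := fun h1 h2 =>
    (eq_or_eq_of_dist_eq_one nLR nUD hUL hUR hDL hDR h1 h2).elim hwU hwD
  have sUD : dist w U = 1 → dist w D = 1 → False := fun h1 h2 =>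
    (eq_or_eq_of_dist_eq_one nUD nLR hLU hLD hRU hRD h1 h2).elim hwL hwR
  simp only [mem_insert_iff, mem_singleton_iff] at hK hK'
  rcases hK with rfl | rfl | rfl | rfl <;> rcases hK' with rfl | rfl | rfl | rfl <;>
    first
    | rfl
    | exact (sLU h h').elim
    | exact (sLU h' h).elim
    | exact (sLD h h').elim
    | exact (sLD h' h).elim
    | exact (sRU h h').elim
    | exact (sRU h' h).elim
    | exact (sRD h h').elim
    | exact (sRD h' h).elim
    | exact (sLR h h').elim
    | exact (sLR h' h).elim
    | exact (sUD h h').elim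
    | exact (sUD h' h).elim

end Unique

section Cycle

variable {P : Finset Pt} {φ : ℝ} {L U R D : Pt}

lemma IsKernel.ne_of_mem_outerNbrs (hP : PennyGP P) (hk : IsKernel P L U R D)
    (h : IsRhombus φ L U R D) {X Y x y : Pt} (hx : x ∈ outerNbrs P {L, U, R, D} X)
    (hy : y ∈ outerNbrs P {L, U, R, D} Y) (hX : X ∈ ({L, U, R, D} : Set Pt))
    (hY : Y ∈ ({L, U, R, D} : Set Pt)) (hXY : X ≠ Y) : x ≠ y := by
  rintro rfl
  exact hXY (hk.eq_of_dist_eq_one hP h.add_eq hx.1 hx.2.1 hX hY hx.2.2 hy.2.2)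

/-- The outer neighbours of a kernel lie in directions differing by multiples of `π / 3`. -/
lemma IsKernel.exists_outerNbrs (hP : PennyGP P) (hk : IsKernel P L U R D)
    (h : IsRhombus φ L U R D) :
    ∃ p, outerNbrs P {L, U, R, D} U =
        {U + unitVec p, U + unitVec (p + π / 3), U + unitVec (p + 2 * π / 3)} ∧
      outerNbrs P {L, U, R, D} L = {L + unitVec (p + 2 * π / 3), L + unitVec (p + π)} ∧
      outerNbrs P {L, U, R, D} D =
        {D + unitVec (p + π), D + unitVec (p + 4 * π / 3), D + unitVec (p + 5 * π / 3)} ∧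
      outerNbrs P {L, U, R, D} R = {R + unitVec (p + 5 * π / 3), R + unitVec p} := by
  have hpi := pi_pos
  have hKP := hk.subset
  have hK : ({R, D, L, U} : Set Pt) = {L, U, R, D} := by
    ext; simp only [mem_insert_iff, mem_singleton_iff]; tauto
  have hgap : ∀ {X Y x y : Pt}, X ∈ ({L, U, R, D} : Set Pt) → Y ∈ ({L, U, R, D} : Set Pt) →
      X ≠ Y → x ∈ outerNbrs P {L, U, R, D} X → y ∈ outerNbrs P {L, U, R, D} Y → 1 ≤ dist x y :=
    fun hX hY hXY hx hy => hP.1 _ hx.1 _ hy.1 (hk.ne_of_mem_outerNbrs hP h hx hy hX hY hXY)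
  obtain ⟨-, -, -, -, hne, dL, dU, dR, dD, -⟩ := hk
  obtain ⟨nLU, nLR, nLD, nUR, nUD, nRD⟩ := pairwise_ne_four.1 hne
  have hne' : List.Pairwise (· ≠ ·) [R, D, L, U] :=
    pairwise_ne_four.2 ⟨nRD, nLR.symm, nUR.symm, nLD.symm, nUD.symm, nLU⟩
  obtain ⟨a, b, ha, hab, hb, oL⟩ := exists_outerNbrs_left hP.1 h hKP hne dL
  obtain ⟨c, d, hc, hcd, hd, oR⟩ := exists_outerNbrs_left hP.1 h.rotate (hK ▸ hKP) hne' dR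
  obtain ⟨p, q, r, hp, hpq, hqr, hr, oU⟩ := exists_outerNbrs_up hP.1 h hKP hne dU
  obtain ⟨s, t, u, hs, hst, htu, hu, oD⟩ :=
    exists_outerNbrs_up hP.1 h.rotate (hK ▸ hKP) hne' dD
  rw [hK] at oR oD
  have hd' : unitVec (d - 2 * π) = unitVec d := by rw [← unitVec_add_two_pi, sub_add_cancel]
  have g1 : d - 2 * π ≤ p := angle_le_of_one_le_dist h.rotate.down
    (by rw [hd']; exact hgap (by simp) (by simp) nUR.symm (by simp [oR]) (by simp [oU]))
    (by linarith) (by linarith)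
  have g2 : r ≤ a := angle_le_of_one_le_dist h.left_eq
    (hgap (by simp) (by simp) nLU.symm (by simp [oU]) (by simp [oL]))
    (by linarith) (by linarith)
  have g3 : b ≤ s := angle_le_of_one_le_dist h.rotate.rotate.down
    (hgap (by simp) (by simp) nLD (by simp [oL]) (by simp [oD]))
    (by linarith) (by linarith)
  have g4 : u ≤ c := angle_le_of_one_le_dist h.rotate.left_eq
    (hgap (by simp) (by simp) nRD.symm (by simp [oD]) (by simp [oR]))
    (by linarith) (by linarith)
  refine ⟨p, ?_, ?_, ?_, ?_⟩
  · rw [oU, show q = p + π / 3 by linarith, show r = p + 2 * π / 3 by linarith]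
  · rw [oL, show a = p + 2 * π / 3 by linarith, show b = p + π by linarith]
  · rw [oD, show s = p + π by linarith, show t = p + 4 * π / 3 by linarith,
      show u = p + 5 * π / 3 by linarith]
  · rw [oR, ← hd', show c = p + 5 * π / 3 by linarith, show d - 2 * π = p by linarith]

lemma IsKernel.exists_cycle (hP : PennyGP P) (hk : IsKernel P L U R D)
    (h : IsRhombus φ L U R D) :
    ∃ w : Fin 10 → Pt, Function.Injective w ∧
      Set.range w =
        {v : Pt | v ∈ P ∧ v ∉ ({L, U, R, D} : Set Pt) ∧
          ∃ K ∈ ({L, U, R, D} : Set Pt), dist v K = 1} ∧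
      ∀ i : Fin 10, dist (w i) (w (i + 1)) = 1 := by
  have hpi := pi_pos
  obtain ⟨p, oU, oL, oD, oR⟩ := hk.exists_outerNbrs hP h
  have huniq := @IsKernel.ne_of_mem_outerNbrs _ _ _ _ _ _ hP hk h
  obtain ⟨-, -, -, -, hne, -, -, -, -, hLU, hUR, hRD, hDL, hLR⟩ := hk
  obtain ⟨nLU, nLR, nLD, nUR, nUD, nRD⟩ := pairwise_ne_four.1 hne
  have mL : L ∈ ({L, U, R, D} : Set Pt) := by simp
  have mU : U ∈ ({L, U, R, D} : Set Pt) := by simp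
  have mR : R ∈ ({L, U, R, D} : Set Pt) := by simp
  have mD : D ∈ ({L, U, R, D} : Set Pt) := by simp
  refine ⟨![U + unitVec p, U + unitVec (p + π / 3), U + unitVec (p + 2 * π / 3),
    L + unitVec (p + 2 * π / 3), L + unitVec (p + π), D + unitVec (p + π),
    D + unitVec (p + 4 * π / 3), D + unitVec (p + 5 * π / 3), R + unitVec (p + 5 * π / 3),
    R + unitVec p], ?_, ?_, ?_⟩
  · rw [← List.nodup_ofFn]
    simp only [List.ofFn_succ, List.ofFn_zero]
    change List.Nodup ([U + unitVec p, U + unitVec (p + π / 3), U + unitVec (p + 2 * π / 3)] ++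
      ([L + unitVec (p + 2 * π / 3), L + unitVec (p + π)] ++ ([D + unitVec (p + π),
      D + unitVec (p + 4 * π / 3), D + unitVec (p + 5 * π / 3)] ++ [R + unitVec (p + 5 * π / 3),
      R + unitVec p])))
    have eU : ∀ x, x ∈ [U + unitVec p, U + unitVec (p + π / 3), U + unitVec (p + 2 * π / 3)] ↔
        x ∈ outerNbrs P {L, U, R, D} U := by simp [oU]
    have eL : ∀ x, x ∈ [L + unitVec (p + 2 * π / 3), L + unitVec (p + π)] ↔
        x ∈ outerNbrs P {L, U, R, D} L := by simp [oL]
    have eD : ∀ x, x ∈ [D + unitVec (p + π), D + unitVec (p + 4 * π / 3),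
        D + unitVec (p + 5 * π / 3)] ↔ x ∈ outerNbrs P {L, U, R, D} D := by simp [oD]
    have eR : ∀ x, x ∈ [R + unitVec (p + 5 * π / 3), R + unitVec p] ↔
        x ∈ outerNbrs P {L, U, R, D} R := by simp [oR]
    rw [List.nodup_append, List.nodup_append, List.nodup_append]
    simp only [List.mem_append, eU, eL, eD, eR]
    refine ⟨?_, ⟨?_, ⟨?_, ?_, ?_⟩, ?_⟩, ?_⟩
    · simp only [List.nodup_cons, List.mem_cons, List.not_mem_nil, or_false, not_or,
        not_false_eq_true, List.nodup_nil, and_true]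
      exact ⟨⟨add_unitVec_ne (by linarith) (by linarith),
        add_unitVec_ne (by linarith) (by linarith)⟩, add_unitVec_ne (by linarith) (by linarith)⟩
    · simp only [List.nodup_cons, List.mem_cons, List.not_mem_nil, or_false,
        not_false_eq_true, List.nodup_nil, and_true]
      exact add_unitVec_ne (by linarith) (by linarith)
    · simp only [List.nodup_cons, List.mem_cons, List.not_mem_nil, or_false, not_or,
        not_false_eq_true, List.nodup_nil, and_true]
      exact ⟨⟨add_unitVec_ne (by linarith) (by linarith),
        add_unitVec_ne (by linarith) (by linarith)⟩, add_unitVec_ne (by linarith) (by linarith)⟩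
    · simp only [List.nodup_cons, List.mem_cons, List.not_mem_nil, or_false,
        not_false_eq_true, List.nodup_nil, and_true]
      exact (add_unitVec_ne (by linarith) (by linarith)).symm
    · exact fun x hx y hy => huniq hx hy mD mR nRD.symm
    · rintro x hx y (hy | hy)
      exacts [huniq hx hy mL mD nLD, huniq hx hy mL mR nLR]
    · rintro x hx y (hy | hy | hy)
      exacts [huniq hx hy mU mL nLU.symm, huniq hx hy mU mD nUD, huniq hx hy mU mR nUR]
  · have hN : {v | v ∈ P ∧ v ∉ ({L, U, R, D} : Set Pt) ∧
        ∃ K ∈ ({L, U, R, D} : Set Pt), dist v K = 1} =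
        outerNbrs P {L, U, R, D} U ∪ (outerNbrs P {L, U, R, D} L ∪
          (outerNbrs P {L, U, R, D} D ∪ outerNbrs P {L, U, R, D} R)) := by
      ext v
      constructor
      · rintro ⟨hv, hvK, K, rfl | rfl | rfl | rfl, hd⟩
        exacts [.inr (.inl ⟨hv, hvK, hd⟩), .inl ⟨hv, hvK, hd⟩, .inr (.inr (.inr ⟨hv, hvK, hd⟩)),
          .inr (.inr (.inl ⟨hv, hvK, hd⟩))]
      · rintro (hv | hv | hv | hv)
        exacts [⟨hv.1, hv.2.1, U, mU, hv.2.2⟩, ⟨hv.1, hv.2.1, L, mL, hv.2.2⟩,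
          ⟨hv.1, hv.2.1, D, mD, hv.2.2⟩, ⟨hv.1, hv.2.1, R, mR, hv.2.2⟩]
    rw [hN, oL, oU, oR, oD]
    simp only [Matrix.range_cons, Matrix.range_empty, union_empty, insert_eq, union_assoc]
  · intro i
    fin_cases i
    · exact dist_add_unitVec_pi_div_three U rfl
    · exact dist_add_unitVec_pi_div_three U (by ring)
    · change dist (U + unitVec _) (L + unitVec _) = 1
      rw [dist_add_right, dist_comm, hLU]
    · exact dist_add_unitVec_pi_div_three L (by ring)
    · change dist (L + unitVec _) (D + unitVec _) = 1
      rw [dist_add_right, dist_comm, hDL]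
    · exact dist_add_unitVec_pi_div_three D (by ring)
    · exact dist_add_unitVec_pi_div_three D (by ring)
    · change dist (D + unitVec _) (R + unitVec _) = 1
      rw [dist_add_right, dist_comm, hRD]
    · rw [dist_comm]
      change dist (R + unitVec p) (R + unitVec (p + 5 * π / 3)) = 1
      rw [← unitVec_add_two_pi p, dist_comm]
      exact dist_add_unitVec_pi_div_three R (by ring)
    · change dist (R + unitVec p) (U + unitVec p) = 1
      rw [dist_add_right, dist_comm, hUR]

end Cycle

end ApricotLemmas

/-- Around each kernel there is an apricot: every point of `P` outside the kernel at
unit distance from one of the kernel points is at unit distance from exactly one of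
them, there are exactly ten such points, and they form a 10-cycle of unit distances. -/
theorem apricot_around_kernel (P : Finset Pt) (hP : PennyGP P) (L U R D : Pt)
    (hk : IsKernel P L U R D) :
    (∀ w ∈ P, w ∉ ({L, U, R, D} : Set Pt) →
      (∃ K ∈ ({L, U, R, D} : Set Pt), dist w K = 1) →
      ∃! K : Pt, K ∈ ({L, U, R, D} : Set Pt) ∧ dist w K = 1) ∧
    (∃ w : Fin 10 → Pt, Function.Injective w ∧
      Set.range w =
        {v : Pt | v ∈ P ∧ v ∉ ({L, U, R, D} : Set Pt) ∧
          ∃ K ∈ ({L, U, R, D} : Set Pt), dist v K = 1} ∧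
      ∀ i : Fin 10, dist (w i) (w (i + 1)) = 1) := by
  have hadd : U + D = L + R := by
    obtain ⟨φ, h | h⟩ := hk.exists_isRhombus
    · exact h.add_eq
    · rw [add_comm, h.add_eq]
  refine ⟨fun w hw hwK ⟨K, hK, hwK1⟩ => ⟨K, ⟨hK, hwK1⟩, fun K' hK' =>
    hk.eq_of_dist_eq_one hP hadd hw hwK hK'.1 hK hK'.2 hwK1⟩, ?_⟩
  obtain ⟨φ, h | h⟩ := hk.exists_isRhombus
  · exact hk.exists_cycle hP h
  · have hK : ({L, D, R, U} : Set Pt) = {L, U, R, D} := by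
      ext; simp only [Set.mem_insert_iff, Set.mem_singleton_iff]; tauto
    have := hk.swap.exists_cycle hP h
    rwa [hK] at this
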